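/- Let V be a locally finite variety with κ(V) = N < ω, let P(c̄) = {p_j(c̄,x1,x2,x3) : 1 ≤ j ≤ K} be terms of V with a fixed finite tuple c̄ of constant symbols, and let J(c̄) be the set consisting of the Jónsson identities for the polynomials P(c̄) in the variables x1, x2, x3. Then the class M = Mod_V(∃c̄ J(c̄)) = {B ∈ V : B ⊨ ∃c̄ J(c̄)} has definable principal subcongruences. -/

import Mathlib

open FirstOrder

namespace McKenzie

/-- A Turing machine instruction `(s, r, w, d, t)`: "in state `s` reading `r`,
write `w`, move in direction `d` (`true` = right, `false` = left), enter state `t`". -/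
structure Instr (n : ℕ) where
  s : Fin (n + 1)
  r : Bool
  w : Bool
  d : Bool
  t : Fin (n + 1)

/-- A Turing machine: a finite list of instructions on states `μ0, …, μn`
(represented by `Fin (states+1)`), where `μ0` is the halting state (carrying no
instructions) and `μ1` is the initial state. -/
structure TM where
  states : ℕ
  instr : List (Instr states)
  halt_no_instr : ∀ i ∈ instr, i.s ≠ 0

/-- A configuration of a Turing machine: a tape, a head position and a state. -/
structure Cfg (T : TM) where
  tape : ℤ → Bool
  head : ℤ
  state : Fin (T.states + 1)

/-- One computation step of the machine (using the first applicable instruction). -/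
def TM.step (T : TM) (Q : Cfg T) : Option (Cfg T) :=
  match T.instr.find? (fun i => decide (i.s = Q.state ∧ i.r = Q.tape Q.head)) with
  | none => none
  | some i =>
      some ⟨Function.update Q.tape Q.head i.w,
        if i.d then Q.head + 1 else Q.head - 1, i.t⟩

/-- The configuration after `n` steps when started in state `μ1` on the blank tape. -/
def TM.run (T : TM) : ℕ → Option (Cfg T)
  | 0 => some ⟨fun _ => false, 0, 1⟩
  | n + 1 => (T.run n).bind T.step

/-- `T` halts (started in the initial state `μ1` on the empty, all-zero, tape). -/
def TM.Halts (T : TM) : Prop := ∃ (n : ℕ) (Q : Cfg T), T.run n = some Q ∧ Q.state = 0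

/-- The universe of the algebra `A'(T)`:
`0`, `U = {1,2,H}`, `W = {C, D, ∂C, ∂D}`, and
`V = {C_ir^s, D_ir^s, M_i^r}` together with their barred versions. -/
inductive El (T : TM) : Type
  | zero
  | one
  | two
  | H
  | C (bar : Bool)
  | D (bar : Bool)
  | Cv (bar : Bool) (i : Fin (T.states + 1)) (r s : Bool)
  | Dv (bar : Bool) (i : Fin (T.states + 1)) (r s : Bool)
  | Mv (bar : Bool) (i : Fin (T.states + 1)) (r : Bool)
  deriving DecidableEq

namespace El

variable {T : TM}

/-- The bar involution `∂`, defined (only) on `V ∪ W`. -/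
def bar : El T → Option (El T)
  | C b => some (C (!b))
  | D b => some (D (!b))
  | Cv b i r s => some (Cv (!b) i r s)
  | Dv b i r s => some (Dv (!b) i r s)
  | Mv b i r => some (Mv (!b) i r)
  | _ => none

/-- The flat (height 1) semilattice meet with bottom element `0`. -/
def meet (x y : El T) : El T := if x = y then x else zero

/-- Join in the flat semilattice, for comparable elements. -/
def fjoin (x y : El T) : El T := if x = zero then y else x

/-- The nonassociative multiplication: `2·D = H·C = D`, `1·C = C`,
`2·∂D = H·∂C = ∂D`, `1·∂C = ∂C`, and `0` otherwise. -/
def mul : El T → El T → El T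
  | two, D b => D b
  | H, C b => D b
  | one, C b => C b
  | _, _ => zero

/-- `J(x,y,z) = (x ∧ ∂y ∧ z) ∨ (x ∧ y)`. -/
def opJ (x y z : El T) : El T :=
  if x = y then x else if bar y = some x then meet x z else zero

/-- `J'(x,y,z) = (x ∧ y ∧ z) ∨ (x ∧ ∂y)`. -/
def opJ' (x y z : El T) : El T :=
  if x = y then meet x z else if bar y = some x then x else zero

/-- `K(x,y,z) = (∂x ∧ y) ∨ (∂x ∧ ∂y ∧ z) ∨ (x ∧ y ∧ z)`. -/
def opK (x y z : El T) : El T :=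
  if bar y = some x then y
  else if x = y ∧ bar z = some x then z
  else meet x (meet y z)

/-- `(x ∧ y) ∨ (x ∧ z)`. -/
def sCore (x y z : El T) : El T := fjoin (meet x y) (meet x z)

/-- Membership in `V₀` (the elements of `V` with state index `0`). -/
def isV0 : El T → Bool
  | Cv _ i _ _ => decide (i = 0)
  | Dv _ i _ _ => decide (i = 0)
  | Mv _ i _ => decide (i = 0)
  | _ => false

/-- `S₀(u,x,y,z) = (x∧y) ∨ (x∧z)` if `u ∈ V₀`, else `0`. -/
def opS0 (u x y z : El T) : El T := if isV0 u then sCore x y z else zero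

/-- `S₁(u,x,y,z) = (x∧y) ∨ (x∧z)` if `u ∈ {1,2}`, else `0`. -/
def opS1 (u x y z : El T) : El T := if u = one ∨ u = two then sCore x y z else zero

/-- `S₂(u,v,x,y,z) = (x∧y) ∨ (x∧z)` if `u = ∂v ∈ V ∪ W`, else `0`. -/
def opS2 (u v x y z : El T) : El T := if bar v = some u then sCore x y z else zero

/-- The operation `T(w,x,y,z)`. -/
def opT (w x y z : El T) : El T :=
  if mul w x = mul y z then
    if w = y ∧ x = z then mul w x
    else if mul w x ≠ zero then (bar (mul w x)).getD zero else zero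
  else zero

/-- `I(1) = C₁₀⁰`, `I(H) = M₁⁰`, `I(2) = D₁₀⁰`, and `0` otherwise. -/
def opI : El T → El T
  | one => Cv false 1 false false
  | H => Mv false 1 false
  | two => Dv false 1 false false
  | _ => zero

/-- The left-moving machine operation `L_{irt}` attached to an instruction
`(μ_i, r, s, L, μ_j)` and `t ∈ {0,1}`. -/
def opL (ins : Instr T.states) (t : Bool) : El T → El T → El T → El T
  | one, one, Cv b i r s' => if i = ins.s ∧ r = ins.r then Cv b ins.t t s' else zero
  | H, one, Cv b i r s' => if i = ins.s ∧ r = ins.r ∧ s' = t then Mv b ins.t t else zero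
  | two, H, Mv b i r => if i = ins.s ∧ r = ins.r then Dv b ins.t t ins.w else zero
  | two, two, Dv b i r s' => if i = ins.s ∧ r = ins.r then Dv b ins.t t s' else zero
  | _, _, _ => zero

/-- The right-moving machine operation `R_{irt}` attached to an instruction
`(μ_i, r, s, R, μ_j)` and `t ∈ {0,1}`. -/
def opR (ins : Instr T.states) (t : Bool) : El T → El T → El T → El T
  | one, one, Cv b i r s' => if i = ins.s ∧ r = ins.r then Cv b ins.t t s' else zero
  | H, one, Mv b i r => if i = ins.s ∧ r = ins.r then Cv b ins.t t ins.w else zero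
  | two, H, Dv b i r s' => if i = ins.s ∧ r = ins.r ∧ s' = t then Mv b ins.t t else zero
  | two, two, Dv b i r s' => if i = ins.s ∧ r = ins.r then Dv b ins.t t s' else zero
  | _, _, _ => zero

/-- The machine operation (from `𝓛 ∪ 𝓡`) attached to an instruction. -/
def mach (ins : Instr T.states) (t : Bool) (x y u : El T) : El T :=
  if ins.d then opR ins t x y u else opL ins t x y u

/-- The relation `≺` on `{1,2,H}`. -/
def prec : El T → El T → Bool
  | two, two => true
  | two, H => true
  | one, one => true
  | _, _ => false

/-- The operation `U_F^1`. -/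
def opU1 (F : El T → El T → El T → El T) (x y z u : El T) : El T :=
  if prec x z then
    if y = z then F x y u
    else if F x y u ≠ zero then (bar (F x y u)).getD zero else zero
  else zero

/-- The operation `U_F^0`. -/
def opU0 (F : El T → El T → El T → El T) (x y z u : El T) : El T :=
  if prec x z then
    if x = y then F y z u
    else if F y z u ≠ zero then (bar (F y z u)).getD zero else zero
  else zero

end El

/-- The unary operation symbols of `A'(T)`. -/
inductive Ops1 : Type
  | I

/-- The binary operation symbols of `A'(T)`. -/
inductive Ops2 : Type
  | meet
  | mul

/-- The ternary operation symbols of `A'(T)`: `J`, `J'`, `K` and the machine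
operations from `𝓛 ∪ 𝓡` (one for each instruction and each `t ∈ {0,1}`). -/
inductive Ops3 (T : TM) : Type
  | J
  | J'
  | K
  | mach (k : Fin T.instr.length) (t : Bool)

/-- The 4-ary operation symbols of `A'(T)`: `S₀`, `S₁`, `T` and the operations
`U_F^1, U_F^0` for `F ∈ 𝓛 ∪ 𝓡`. -/
inductive Ops4 (T : TM) : Type
  | S0
  | S1
  | T
  | u1 (k : Fin T.instr.length) (t : Bool)
  | u0 (k : Fin T.instr.length) (t : Bool)

/-- The 5-ary operation symbols of `A'(T)`: `S₂`. -/
inductive Ops5 : Type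
  | S2

/-- The signature (similarity type) of the algebra `A'(T)`; the constant symbol
(of arity 0) denotes the bottom element `0`. -/
def Sig (T : TM) : FirstOrder.Language.{0, 0} where
  Functions n :=
    match n with
    | 0 => PUnit
    | 1 => Ops1
    | 2 => Ops2
    | 3 => Ops3 T
    | 4 => Ops4 T
    | 5 => Ops5
    | _ => PEmpty
  Relations _ := PEmpty


/-- The constant symbol `0` as an element of the signature. -/
def fn0 (T : TM) : (Sig T).Functions 0 := PUnit.unit
/-- Unary operation symbols as elements of the signature. -/
def fn1 (T : TM) (o : Ops1) : (Sig T).Functions 1 := o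
/-- Binary operation symbols as elements of the signature. -/
def fn2 (T : TM) (o : Ops2) : (Sig T).Functions 2 := o
/-- Ternary operation symbols as elements of the signature. -/
def fn3 (T : TM) (o : Ops3 T) : (Sig T).Functions 3 := o
/-- 4-ary operation symbols as elements of the signature. -/
def fn4 (T : TM) (o : Ops4 T) : (Sig T).Functions 4 := o
/-- 5-ary operation symbols as elements of the signature. -/
def fn5 (T : TM) (o : Ops5) : (Sig T).Functions 5 := o

/-- The algebra `A'(T)`: the interpretation of the signature `Sig T` on `El T`. -/
instance elStructure (T : TM) : (Sig T).Structure (El T) where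
  funMap {n} f v :=
    match n, f, v with
    | 0, _, _ => El.zero
    | 1, Ops1.I, v => El.opI (v 0)
    | 2, Ops2.meet, v => El.meet (v 0) (v 1)
    | 2, Ops2.mul, v => El.mul (v 0) (v 1)
    | 3, Ops3.J, v => El.opJ (v 0) (v 1) (v 2)
    | 3, Ops3.J', v => El.opJ' (v 0) (v 1) (v 2)
    | 3, Ops3.K, v => El.opK (v 0) (v 1) (v 2)
    | 3, Ops3.mach k t, v => El.mach (T.instr.get k) t (v 0) (v 1) (v 2)
    | 4, Ops4.S0, v => El.opS0 (v 0) (v 1) (v 2) (v 3)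
    | 4, Ops4.S1, v => El.opS1 (v 0) (v 1) (v 2) (v 3)
    | 4, Ops4.T, v => El.opT (v 0) (v 1) (v 2) (v 3)
    | 4, Ops4.u1 k t, v => El.opU1 (El.mach (T.instr.get k) t) (v 0) (v 1) (v 2) (v 3)
    | 4, Ops4.u0 k t, v => El.opU0 (El.mach (T.instr.get k) t) (v 0) (v 1) (v 2) (v 3)
    | 5, Ops5.S2, v => El.opS2 (v 0) (v 1) (v 2) (v 3) (v 4)
    | _ + 6, f, _ => f.elim
  RelMap {n} r _ := r.elim

/-- The product algebra `A'(T)^ι`. -/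
instance piStructure (T : TM) (ι : Type*) : (Sig T).Structure (ι → El T) where
  funMap f v l := Language.Structure.funMap f fun i => v i l
  RelMap r _ := r.elim

open Language

/-- A congruence of an algebra: an equivalence relation compatible with all the
fundamental operations. -/
def IsCongruence (L : Language) (B : Type*) [L.Structure B] (ρ : B → B → Prop) : Prop :=
  Equivalence ρ ∧
    ∀ {n : ℕ} (f : L.Functions n) (v w : Fin n → B),
      (∀ i, ρ (v i) (w i)) → ρ (Structure.funMap f v) (Structure.funMap f w)

/-- `PrinCg L B a b x y` says that `(x, y)` lies in the principal congruence
`Cg^B(a,b)` generated by the pair `(a,b)`. -/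
def PrinCg (L : Language) (B : Type*) [L.Structure B] (a b x y : B) : Prop :=
  ∀ ρ : B → B → Prop, IsCongruence L B ρ → ρ a b → ρ x y

/-- `B` satisfies every identity holding in `A`; by Birkhoff's theorem this says
exactly that `B` belongs to the variety generated by `A`. -/
def ModelsIdsOf (L : Language) (A : Type*) [L.Structure A] (B : Type*) [L.Structure B] : Prop :=
  ∀ t₁ t₂ : L.Term ℕ,
    (∀ v : ℕ → A, t₁.realize v = t₂.realize v) →
    ∀ v : ℕ → B, t₁.realize v = t₂.realize v

/-- Membership in the variety `V(A'(T))` generated by `A'(T)`. -/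
def InVariety (T : TM) (B : Type*) [(Sig T).Structure B] : Prop :=
  ModelsIdsOf (Sig T) (El T) B

/-- The variety `V(A'(T))` as a class of algebras. -/
def VClass (T : TM) : ∀ (B : Type) [inst : (Sig T).Structure B], Prop :=
  fun B inst => @InVariety T B inst

/-- `φ(w,x,y,z)` is a congruence formula for the class `C`: in every member of `C`
it implies `(w,x) ∈ Cg(y,z)`. -/
def IsCongruenceFormula (L : Language) (C : ∀ (B : Type) [inst : L.Structure B], Prop)
    (φ : L.Formula (Fin 4)) : Prop :=
  ∀ (B : Type) [L.Structure B], C B → ∀ w x y z : B,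
    φ.Realize ![w, x, y, z] → PrinCg L B y z w x

/-- The class `C` has definable principal subcongruences: there are congruence
formulas `Γ` and `ψ` such that any pair `a ≠ b` admits a subpair `c ≠ d` of
`Cg(a,b)` (witnessed by `Γ`) whose principal congruence is defined by `ψ`. -/
def HasDPSC (L : Language) (C : ∀ (B : Type) [inst : L.Structure B], Prop) : Prop :=
  ∃ Γ ψ : L.Formula (Fin 4),
    IsCongruenceFormula L C Γ ∧ IsCongruenceFormula L C ψ ∧
      ∀ (B : Type) [L.Structure B], C B → ∀ a b : B, a ≠ b →
        ∃ c d : B, c ≠ d ∧ Γ.Realize ![c, d, a, b] ∧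
          ∀ x y : B, PrinCg L B c d x y ↔ ψ.Realize ![x, y, c, d]

/-- The variety `V(A'(T))` is axiomatized by a finite set of identities
(which hold in `A'(T)`). -/
def FinitelyBased (T : TM) : Prop :=
  ∃ E : List ((Sig T).Term ℕ × (Sig T).Term ℕ),
    (∀ e ∈ E, ∀ v : ℕ → El T, e.1.realize v = e.2.realize v) ∧
    ∀ (B : Type) [(Sig T).Structure B],
      (InVariety T B ↔ ∀ e ∈ E, ∀ v : ℕ → B, e.1.realize v = e.2.realize v)

/-- An algebra is subdirectly irreducible iff some pair `a ≠ b` (generating the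
monolith) belongs to every nontrivial congruence. -/
def IsSI (L : Language) (B : Type*) [L.Structure B] : Prop :=
  ∃ a b : B, a ≠ b ∧ ∀ c d : B, c ≠ d → PrinCg L B c d a b

/-- An algebra is finitely subdirectly irreducible iff any two nontrivial principal
congruences have nontrivial intersection. -/
def IsFSI (L : Language) (B : Type*) [L.Structure B] : Prop :=
  ∀ a b c d : B, a ≠ b → c ≠ d →
    ∃ x y : B, x ≠ y ∧ PrinCg L B a b x y ∧ PrinCg L B c d x y

/-- The residual bound of `V(A'(T))` is finite (`κ(A'(T)) < ω`): there is a finite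
bound strictly larger than the cardinality of every subdirectly irreducible member. -/
def ResBoundFinite (T : TM) : Prop :=
  ∃ N : ℕ, ∀ (B : Type) [(Sig T).Structure B],
    InVariety T B → IsSI (Sig T) B → Finite B ∧ Nat.card B < N

/-- Membership in `HS(A'(T))`: homomorphic images of subalgebras of `A'(T)`. -/
def InHS (T : TM) (B : Type*) [(Sig T).Structure B] : Prop :=
  ∃ (S : (Sig T).Substructure (El T)) (f : S →[Sig T] B), Function.Surjective f

/-- The constant `0` of an algebra in the signature of `A'(T)`. -/
def zeroB (T : TM) (B : Type*) [(Sig T).Structure B] : B :=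
  Structure.funMap (fn0 T) (fun i : Fin 0 => i.elim0)

/-- The meet operation of an algebra in the signature of `A'(T)`. -/
def meetB (T : TM) {B : Type*} [(Sig T).Structure B] (x y : B) : B :=
  Structure.funMap (fn2 T Ops2.meet) ![x, y]

/-- The multiplication of an algebra in the signature of `A'(T)`. -/
def mulB (T : TM) {B : Type*} [(Sig T).Structure B] (x y : B) : B :=
  Structure.funMap (fn2 T Ops2.mul) ![x, y]

/-- The operation `I` of an algebra in the signature of `A'(T)`. -/
def IB (T : TM) {B : Type*} [(Sig T).Structure B] (x : B) : B :=
  Structure.funMap (fn1 T Ops1.I) ![x]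

/-- The operation `J` of an algebra in the signature of `A'(T)`. -/
def JB (T : TM) {B : Type*} [(Sig T).Structure B] (x y z : B) : B :=
  Structure.funMap (fn3 T Ops3.J) ![x, y, z]

/-- The operation `J'` of an algebra in the signature of `A'(T)`. -/
def J'B (T : TM) {B : Type*} [(Sig T).Structure B] (x y z : B) : B :=
  Structure.funMap (fn3 T Ops3.J') ![x, y, z]

/-- The operation `K` of an algebra in the signature of `A'(T)`. -/
def KB (T : TM) {B : Type*} [(Sig T).Structure B] (x y z : B) : B :=
  Structure.funMap (fn3 T Ops3.K) ![x, y, z]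

/-- The operation `S₂` of an algebra in the signature of `A'(T)`. -/
def S2B (T : TM) {B : Type*} [(Sig T).Structure B] (u v x y z : B) : B :=
  Structure.funMap (fn5 T Ops5.S2) ![u, v, x, y, z]

/-- The term `e₂(m,n,x) = S₂(m,n,x,x,x)`. -/
def e2B (T : TM) {B : Type*} [(Sig T).Structure B] (m n x : B) : B :=
  S2B T m n x x x

/-- The semilattice order of an algebra in the signature of `A'(T)`:
`x ≤ y` iff `x ∧ y = x`. -/
def leB (T : TM) {B : Type*} [(Sig T).Structure B] (x y : B) : Prop :=
  meetB T x y = x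

/-- Parameters `m̄ ∈ B² ∪ B` for one of the operations `S₀`, `S₁`, `S₂`. -/
inductive SIdx (B : Type*) : Type _
  | s0 (m : B)
  | s1 (m : B)
  | s2 (m n : B)

/-- Which of `S₀, S₁, S₂` a parameter tuple belongs to. -/
def SIdx.tag {B : Type*} : SIdx B → Fin 3
  | .s0 _ => 0
  | .s1 _ => 1
  | .s2 _ _ => 2

/-- `SApp T σ x y z` is `S_i(m̄, x, y, z)` where `σ` packages `i` and `m̄`. -/
def SApp (T : TM) {B : Type*} [(Sig T).Structure B] : SIdx B → B → B → B → B
  | .s0 m, x, y, z => Structure.funMap (fn4 T Ops4.S0) ![m, x, y, z]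
  | .s1 m, x, y, z => Structure.funMap (fn4 T Ops4.S1) ![m, x, y, z]
  | .s2 m n, x, y, z => S2B T m n x y z

/-- `eApp T σ x` is the term function `e_i(m̄, x) = S_i(m̄, x, x, x)`. -/
def eApp (T : TM) {B : Type*} [(Sig T).Structure B] (σ : SIdx B) (x : B) : B :=
  SApp T σ x x x

/-- `Range(S_j)`: the set of values of the operation `S_j` on `B`. -/
def SRange (T : TM) (B : Type*) [(Sig T).Structure B] (j : Fin 3) : Set B :=
  {w | ∃ (σ : SIdx B) (x y z : B), σ.tag = j ∧ SApp T σ x y z = w}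

/-- A unary polynomial of `B`: a term function in one variable with parameters
from `B`. -/
def IsPolynomial (T : TM) {B : Type*} [(Sig T).Structure B] (f : B → B) : Prop :=
  ∃ t : (Sig T).Term (B ⊕ Unit), ∀ x : B, f x = t.realize (Sum.elim id fun _ => x)

/-- A fundamental translation: a unary polynomial obtained from a fundamental
operation by fixing all arguments but one. -/
def IsFundTranslation (T : TM) {B : Type*} [(Sig T).Structure B] (g : B → B) : Prop :=
  ∃ (n : ℕ) (F : (Sig T).Functions n) (i : Fin n) (v : Fin n → B),
    g = fun x => Structure.funMap F (Function.update v i x)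

/-- A polynomial generated by fundamental translations: a composition of finitely
many fundamental translations. -/
inductive IsTransPoly (T : TM) {B : Type*} [(Sig T).Structure B] : (B → B) → Prop
  | id : IsTransPoly T id
  | comp {g f : B → B} : IsFundTranslation T g → IsTransPoly T f → IsTransPoly T (g ∘ f)

end McKenzie

namespace McKenzie

open FirstOrder Language

/-- `c : Fin m → B` witnesses the Jónsson identities for the polynomials
`p_0(c̄,x,y,z), …, p_K(c̄,x,y,z)` (terms with constants `c̄`): `p_0(x,y,z) = x`,
`p_K(x,y,z) = z`, `p_j(x,y,x) = x` for all `j`, `p_j(x,x,z) = p_{j+1}(x,x,z)` for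
even `j` and `p_j(x,z,z) = p_{j+1}(x,z,z)` for odd `j`. -/
def JonssonWitness (L : Language) {B : Type*} [L.Structure B] {m K : ℕ}
    (p : Fin (K + 1) → L.Term (Fin m ⊕ Fin 3)) (c : Fin m → B) : Prop :=
  ∀ x y z : B,
    (p 0).realize (Sum.elim c ![x, y, z]) = x ∧
    (p (Fin.last K)).realize (Sum.elim c ![x, y, z]) = z ∧
    (∀ j : Fin (K + 1), (p j).realize (Sum.elim c ![x, y, x]) = x) ∧
    (∀ j : Fin K, Even (j : ℕ) →
      (p j.castSucc).realize (Sum.elim c ![x, x, z]) =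
        (p j.succ).realize (Sum.elim c ![x, x, z])) ∧
    (∀ j : Fin K, Odd (j : ℕ) →
      (p j.castSucc).realize (Sum.elim c ![x, z, z]) =
        (p j.succ).realize (Sum.elim c ![x, z, z]))

/-- `B` satisfies all the identities in `E`. -/
def Satisfies (L : FirstOrder.Language.{0, 0}) (E : Set (L.Term ℕ × L.Term ℕ)) (B : Type)
    [L.Structure B] : Prop :=
  ∀ e ∈ E, ∀ v : ℕ → B, e.1.realize v = e.2.realize v

/-- `η` is maximal among the congruences of `B` that do not contain `(x, y)`. -/
def MaxSep (L : Language) (B : Type*) [L.Structure B] (x y : B) (η : B → B → Prop) : Prop :=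
  IsCongruence L B η ∧ ¬ η x y ∧
    ∀ ρ : B → B → Prop, IsCongruence L B ρ → η ≤ ρ → ¬ ρ x y → ρ ≤ η

section Congruence

variable {L : FirstOrder.Language.{0, 0}} {A B : Type} [L.Structure A] [L.Structure B]

theorem isCongruence_of_translation {ρ : B → B → Prop} (he : Equivalence ρ)
    (h : ∀ {n : ℕ} (f : L.Functions n) (z : Fin n → B) (i : Fin n) (u v : B), ρ u v →
      ρ (Structure.funMap f (Function.update z i u)) (Structure.funMap f (Function.update z i v))) :
    IsCongruence L B ρ := by
  classical
  refine ⟨he, fun {n} f v w hvw => ?_⟩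
  have key : ∀ s : Finset (Fin n),
      ρ (Structure.funMap f v) (Structure.funMap f fun i => if i ∈ s then w i else v i) := by
    intro s
    induction s using Finset.induction_on with
    | empty => simpa using he.refl _
    | insert a s ha ih =>
      refine he.trans ih ?_
      have := h f (fun i => if i ∈ s then w i else v i) a (v a) (w a) (hvw a)
      convert this using 2
      · funext i
        by_cases hi : i = a
        · subst hi; simp [ha]
        · simp [hi]
      · funext i
        by_cases hi : i = a
        · subst hi; simp
        · simp [hi]
  simpa using key Finset.univ

theorem IsCongruence.realize_term {ρ : B → B → Prop} (h : IsCongruence L B ρ) {α : Type}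
    (t : L.Term α) {v w : α → B} (hvw : ∀ i, ρ (v i) (w i)) : ρ (t.realize v) (t.realize w) := by
  induction t with
  | var i => exact hvw i
  | func f ts ih => exact h.2 f _ _ ih

theorem IsCongruence.comap {ρ : B → B → Prop} (h : IsCongruence L B ρ) {g : A → B}
    (hg : ∀ {n : ℕ} (f : L.Functions n) (v : Fin n → A),
      g (Structure.funMap f v) = Structure.funMap f fun i => g (v i)) :
    IsCongruence L A fun u v => ρ (g u) (g v) := by
  refine ⟨⟨fun _ => h.1.refl _, fun h' => h.1.symm h', fun h₁ h₂ => h.1.trans h₁ h₂⟩, ?_⟩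
  intro n f v w hvw
  simp only [hg]
  exact h.2 f _ _ hvw

theorem IsCongruence.restrict {ρ : B → B → Prop} (h : IsCongruence L B ρ)
    (S : L.Substructure B) : IsCongruence L S fun u v => ρ u v :=
  h.comap (g := Subtype.val) fun _ _ => rfl

theorem isCongruence_sInf {𝒞 : Set (B → B → Prop)} (h : ∀ θ ∈ 𝒞, IsCongruence L B θ) :
    IsCongruence L B fun u v => ∀ θ ∈ 𝒞, θ u v :=
  ⟨⟨fun _ θ hθ => (h θ hθ).1.refl _, fun h' θ hθ => (h θ hθ).1.symm (h' θ hθ),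
    fun h₁ h₂ θ hθ => (h θ hθ).1.trans (h₁ θ hθ) (h₂ θ hθ)⟩,
    fun f v w hvw θ hθ => (h θ hθ).2 f v w fun i => hvw i θ hθ⟩

theorem isCongruence_prinCg (a b : B) : IsCongruence L B (PrinCg L B a b) :=
  ⟨⟨fun _ _ hρ _ => hρ.1.refl _, fun h ρ hρ hab => hρ.1.symm (h ρ hρ hab),
    fun h₁ h₂ ρ hρ hab => hρ.1.trans (h₁ ρ hρ hab) (h₂ ρ hρ hab)⟩,
    fun f v w hvw ρ hρ hab => hρ.2 f v w fun i => hvw i ρ hρ hab⟩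

/-- The join of two congruences. -/
def congrJoin (β γ : B → B → Prop) : B → B → Prop :=
  Relation.EqvGen fun u v => β u v ∨ γ u v

theorem isCongruence_congrJoin {β γ : B → B → Prop} (hβ : IsCongruence L B β)
    (hγ : IsCongruence L B γ) : IsCongruence L B (congrJoin β γ) := by
  refine isCongruence_of_translation (Relation.EqvGen.is_equivalence _) ?_
  intro n f z i u v huv
  have upd : ∀ {θ : B → B → Prop}, IsCongruence L B θ → ∀ {u v}, θ u v →
      θ (Structure.funMap f (Function.update z i u))
        (Structure.funMap f (Function.update z i v)) := by
    intro θ hθ u v h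
    refine hθ.2 f _ _ fun j => ?_
    by_cases hj : j = i
    · subst hj; simpa using h
    · simpa [hj] using hθ.1.refl _
  induction huv with
  | rel u v h => exact .rel _ _ (h.imp (upd hβ) (upd hγ))
  | refl u => exact .refl _
  | symm u v _ ih => exact .symm _ _ ih
  | trans u v w _ _ ih₁ ih₂ => exact .trans _ _ _ ih₁ ih₂

theorem exists_maxSep {x y : B} {θ : B → B → Prop} (hθ : IsCongruence L B θ) (hxy : ¬ θ x y) :
    ∃ η, θ ≤ η ∧ MaxSep L B x y η := by
  have hub : ∀ c ⊆ {ρ : B → B → Prop | IsCongruence L B ρ ∧ ¬ ρ x y}, IsChain (· ≤ ·) c → ∀ y' ∈ c,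
      ∃ ub ∈ {ρ : B → B → Prop | IsCongruence L B ρ ∧ ¬ ρ x y}, ∀ z ∈ c, z ≤ ub := by
    intro c hc hchain ρ₀ hρ₀
    refine ⟨fun u v => ∃ ρ ∈ c, ρ u v, ⟨?_, ?_⟩, fun ρ hρ u v h => ⟨ρ, hρ, h⟩⟩
    · refine isCongruence_of_translation
        ⟨fun u => ⟨ρ₀, hρ₀, (hc hρ₀).1.1.refl u⟩,
          fun ⟨ρ, hρ, h⟩ => ⟨ρ, hρ, (hc hρ).1.1.symm h⟩, ?_⟩ ?_
      · rintro u v w ⟨ρ, hρ, h⟩ ⟨ρ', hρ', h'⟩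
        rcases hchain.total hρ hρ' with hle | hle
        · exact ⟨ρ', hρ', (hc hρ').1.1.trans (hle _ _ h) h'⟩
        · exact ⟨ρ, hρ, (hc hρ).1.1.trans h (hle _ _ h')⟩
      · rintro n f z i u v ⟨ρ, hρ, h⟩
        refine ⟨ρ, hρ, (hc hρ).1.2 f _ _ fun j => ?_⟩
        by_cases hj : j = i
        · subst hj; simpa using h
        · simpa [hj] using (hc hρ).1.1.refl _
    · rintro ⟨ρ, hρ, h⟩
      exact (hc hρ).2 h
  obtain ⟨η, hle, hmax⟩ := zorn_le_nonempty₀ _ hub θ ⟨hθ, hxy⟩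
  exact ⟨η, hle, hmax.prop.1, hmax.prop.2,
    fun ρ hρ hηρ hn => hmax.le_of_ge (y := ρ) ⟨hρ, hn⟩ hηρ⟩

theorem isCongruence_eq : IsCongruence L B (· = ·) :=
  ⟨eq_equivalence, fun f _ _ h => congrArg (Structure.funMap f) (funext h)⟩

/-- A congruence of a subalgebra meeting every `θ`-class extends along `θ`. -/
theorem exists_extension {θ : B → B → Prop} (hθ : IsCongruence L B θ) (S : L.Substructure B)
    (hS : ∀ u : B, ∃ s : S, θ u s) {ρ : S → S → Prop} (hρ : IsCongruence L S ρ)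
    (hle : ∀ u v : S, θ u v → ρ u v) :
    ∃ ρ' : B → B → Prop, IsCongruence L B ρ' ∧ θ ≤ ρ' ∧ ∀ u v : S, ρ' u v ↔ ρ u v := by
  choose g hg using hS
  have hgg : ∀ u v, θ u v → ρ (g u) (g v) := fun u v h =>
    hle _ _ (hθ.1.trans (hθ.1.symm (hg u)) (hθ.1.trans h (hg v)))
  have hgS : ∀ u : S, ρ (g u) u := fun u => hle _ _ (hθ.1.symm (hg u))
  refine ⟨fun u v => ρ (g u) (g v), ⟨⟨fun _ => hρ.1.refl _, fun h => hρ.1.symm h,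
    fun h₁ h₂ => hρ.1.trans h₁ h₂⟩, fun {n} f v w hvw => ?_⟩, hgg, fun u v => ?_⟩
  · have hf : ∀ v : Fin n → B, ρ (g (Structure.funMap f v)) (Structure.funMap f fun i => g (v i)) :=
      fun v => hle _ _ (hθ.1.trans (hθ.1.symm (hg _)) (hθ.2 f _ _ fun i => hg (v i)))
    exact hρ.1.trans (hf v) (hρ.1.trans (hρ.2 f _ _ hvw) (hρ.1.symm (hf w)))
  · exact ⟨fun h => hρ.1.trans (hρ.1.symm (hgS u)) (hρ.1.trans h (hgS v)),
      fun h => hρ.1.trans (hgS u) (hρ.1.trans h (hρ.1.symm (hgS v)))⟩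

/-- Maximality of a separating congruence passes to subalgebras meeting all its classes. -/
theorem MaxSep.restrict {x y : B} {η : B → B → Prop} (h : MaxSep L B x y η)
    (S : L.Substructure B) (hS : ∀ u : B, ∃ s : S, η u s) :
    ∃ x' y' : S, MaxSep L S x' y' fun u v => η u v := by
  obtain ⟨x', hx⟩ := hS x
  obtain ⟨y', hy⟩ := hS y
  have he := h.1.1
  refine ⟨x', y', h.1.restrict S, fun hn => h.2.1 (he.trans hx (he.trans hn (he.symm hy))), ?_⟩
  intro ρ hρ hle hn
  obtain ⟨ρ', hρ', hle', hiff⟩ := exists_extension h.1 S hS hρ hle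
  have : ρ' ≤ η := h.2.2 ρ' hρ' hle' fun hxy => hn <| (hiff _ _).1 <|
    hρ'.1.trans (hρ'.1.symm (hle' _ _ hx)) (hρ'.1.trans hxy (hle' _ _ hy))
  exact fun u v huv => this _ _ ((hiff u v).2 huv)

end Congruence

section Quotient

variable {L : FirstOrder.Language.{0, 0}} {B : Type} [L.Structure B]

/-- The quotient of an algebra by a congruence; all relations are taken to hold. -/
@[reducible]
noncomputable def quotStructure (s : Setoid B) : L.Structure (Quotient s) where
  funMap f v := Quotient.mk s (Structure.funMap f fun i => (v i).out)
  RelMap _ _ := True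

theorem quot_funMap {s : Setoid B} (h : IsCongruence L B s.r) {n : ℕ} (f : L.Functions n)
    (v : Fin n → B) :
    Quotient.mk s (Structure.funMap f v) =
      @Structure.funMap L _ (quotStructure s) n f fun i => Quotient.mk s (v i) :=
  Quotient.sound (h.2 f _ _ fun i => s.symm' (Quotient.mk_out (v i)))

theorem quot_realize {s : Setoid B} (h : IsCongruence L B s.r) {α : Type} (t : L.Term α)
    (v : α → B) :
    @Term.realize L _ (quotStructure s) α (fun i => Quotient.mk s (v i)) t =
      Quotient.mk s (t.realize v) := by
  let _ := quotStructure (L := L) s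
  induction t with
  | var i => rfl
  | func f ts ih =>
    simp only [Term.realize, ih]
    exact (quot_funMap h f _).symm

theorem Satisfies.quot {E : Set (L.Term ℕ × L.Term ℕ)} {s : Setoid B} (h : IsCongruence L B s.r)
    (hE : ∀ e ∈ E, ∀ v : ℕ → B, s.r (e.1.realize v) (e.2.realize v)) :
    @Satisfies L E (Quotient s) (quotStructure s) := by
  intro e he v
  have hv : v = fun i => Quotient.mk s (v i).out := funext fun i => (Quotient.out_eq _).symm
  rw [hv, quot_realize h, quot_realize h]
  exact Quotient.sound (hE e he _)

theorem realize_coe (S : L.Substructure B) {α : Type} (t : L.Term α) (v : α → S) :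
    ((t.realize v : S) : B) = t.realize fun i => (v i : B) :=
  (HomClass.realize_term S.subtype (t := t) (v := v)).symm

theorem Satisfies.substructure {E : Set (L.Term ℕ × L.Term ℕ)} (h : Satisfies L E B)
    (S : L.Substructure B) : Satisfies L E S := fun e he v =>
  Subtype.ext (by rw [realize_coe, realize_coe]; exact h e he _)

theorem MaxSep.isSI {x y : B} {s : Setoid B} (h : MaxSep L B x y s.r) :
    @IsSI L (Quotient s) (quotStructure s) := by
  let _ := quotStructure (L := L) s
  refine ⟨Quotient.mk s x, Quotient.mk s y, fun he => h.2.1 (Quotient.exact he), ?_⟩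
  intro c d hcd ρ hρ hρcd
  by_contra hn
  have hle := h.2.2 (fun u v => ρ (Quotient.mk s u) (Quotient.mk s v))
    (hρ.comap fun f v => quot_funMap h.1 f v)
    (fun u v huv => by
      have hq : Quotient.mk s u = Quotient.mk s v := Quotient.sound huv
      simpa only [hq] using hρ.1.refl _) hn
  apply hcd
  rw [← Quotient.out_eq c, ← Quotient.out_eq d]
  exact Quotient.sound (hle _ _ (by simpa only [Quotient.out_eq] using hρcd))

end Quotient

section Jonsson

variable {L : FirstOrder.Language.{0, 0}} {B : Type} [L.Structure B] {m K : ℕ}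
  {p : Fin (K + 1) → L.Term (Fin m ⊕ Fin 3)} {c : Fin m → B}

theorem JonssonWitness.substructure (hc : JonssonWitness L p c) (S : L.Substructure B)
    (hS : ∀ i, c i ∈ S) : JonssonWitness L p fun i => (⟨c i, hS i⟩ : S) := by
  have key : ∀ (j : Fin (K + 1)) (x y z : S),
      (((p j).realize (Sum.elim (fun i => (⟨c i, hS i⟩ : S)) ![x, y, z]) : S) : B) =
        (p j).realize (Sum.elim c ![(x : B), y, z]) := by
    intro j x y z
    rw [realize_coe]
    congr 1
    funext i
    rcases i with i | i
    · rfl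
    · fin_cases i <;> rfl
  intro x y z
  obtain ⟨h₀, h₁, h₂, h₃, h₄⟩ := hc x y z
  refine ⟨Subtype.ext ?_, Subtype.ext ?_, fun j => Subtype.ext ?_,
    fun j hj => Subtype.ext ?_, fun j hj => Subtype.ext ?_⟩ <;> simp only [key]
  · exact h₀
  · exact h₁
  · exact h₂ j
  · exact h₃ j hj
  · exact h₄ j hj

/-- Congruence distributivity of an algebra with Jónsson polynomials. -/
theorem JonssonWitness.distrib (hc : JonssonWitness L p c) {α β γ δ : B → B → Prop}
    (hα : IsCongruence L B α) (hβ : IsCongruence L B β) (hγ : IsCongruence L B γ)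
    (hδ : IsCongruence L B δ) (hαβ : ∀ u v, α u v → β u v → δ u v)
    (hαγ : ∀ u v, α u v → γ u v → δ u v) {x y : B} (hx : α x y) (hj : congrJoin β γ x y) :
    δ x y := by
  have hp : ∀ {θ : B → B → Prop}, IsCongruence L B θ → ∀ (j : Fin (K + 1)) {u u' v v' : B},
      θ u u' → θ v v' → θ ((p j).realize (Sum.elim c ![x, u, v]))
        ((p j).realize (Sum.elim c ![x, u', v'])) := by
    intro θ hθ j u u' v v' hu hv
    refine hθ.realize_term _ fun i => ?_
    rcases i with i | i
    · exact hθ.1.refl _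
    · fin_cases i
      · exact hθ.1.refl _
      · exact hu
      · exact hv
  have hαx : ∀ (j : Fin (K + 1)) (u : B), α ((p j).realize (Sum.elim c ![x, u, y])) x := by
    intro j u
    have := hp hα j (hα.1.refl u) (hα.1.symm hx)
    rwa [(hc x u x).2.2.1 j] at this
  have hstep : ∀ (j : Fin (K + 1)) {u v : B}, congrJoin β γ u v →
      δ ((p j).realize (Sum.elim c ![x, u, y])) ((p j).realize (Sum.elim c ![x, v, y])) := by
    intro j u v huv
    induction huv with
    | rel u v h =>
      have hα' := hα.1.trans (hαx j u) (hα.1.symm (hαx j v))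
      rcases h with h | h
      · exact hαβ _ _ hα' (hp hβ j h (hβ.1.refl y))
      · exact hαγ _ _ hα' (hp hγ j h (hγ.1.refl y))
    | refl u => exact hδ.1.refl _
    | symm u v _ ih => exact hδ.1.symm ih
    | trans u v w _ _ ih₁ ih₂ => exact hδ.1.trans ih₁ ih₂
  have hchain : ∀ j : Fin (K + 1), δ x ((p j).realize (Sum.elim c ![x, x, y])) := by
    intro j
    induction j using Fin.induction with
    | zero => rw [(hc x x y).1]; exact hδ.1.refl _
    | succ j ih =>
      rcases Nat.even_or_odd (j : ℕ) with hj' | hj'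
      · rwa [← (hc x x y).2.2.2.1 j hj']
      · have h₁ := hstep j.castSucc hj
        rw [(hc x x y).2.2.2.2 j hj'] at h₁
        exact hδ.1.trans ih (hδ.1.trans h₁ (hδ.1.symm (hstep j.succ hj)))
  have := hchain (Fin.last K)
  rwa [(hc x x y).2.1] at this

/-- A maximal separating congruence is meet-prime. -/
theorem MaxSep.prime (hc : JonssonWitness L p c) {x y : B} {σ θ₁ θ₂ : B → B → Prop}
    (hσ : MaxSep L B x y σ) (h₁ : IsCongruence L B θ₁) (h₂ : IsCongruence L B θ₂)
    (h : ∀ u v, θ₁ u v → θ₂ u v → σ u v) : θ₁ ≤ σ ∨ θ₂ ≤ σ := by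
  by_contra! hn
  have key : ∀ {θ : B → B → Prop}, IsCongruence L B θ → ¬ θ ≤ σ → congrJoin σ θ x y := by
    intro θ hθ hle
    by_contra hxy
    exact hle fun u v huv => hσ.2.2 _ (isCongruence_congrJoin hσ.1 hθ)
      (fun u v huv => .rel _ _ (Or.inl huv)) hxy _ _ (.rel _ _ (Or.inr huv))
  refine hσ.2.1 (hc.distrib (isCongruence_congrJoin hσ.1 h₁) hσ.1 h₂ hσ.1
    (fun _ _ _ h => h) (fun u v hj huv => ?_) (key h₁ hn.1) (key h₂ hn.2))
  exact hc.distrib h₂ hσ.1 h₁ hσ.1 (fun _ _ _ h => h) (fun u v h' h'' => h u v h'' h') huv hj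

theorem MaxSep.prime_sInf [Finite B] (hc : JonssonWitness L p c) {x y : B} {σ : B → B → Prop}
    (hσ : MaxSep L B x y σ) (𝒞 : Set (B → B → Prop)) (h𝒞 : ∀ θ ∈ 𝒞, IsCongruence L B θ)
    (h : ∀ u v, (∀ θ ∈ 𝒞, θ u v) → σ u v) : ∃ θ ∈ 𝒞, θ ≤ σ := by
  induction 𝒞, Set.toFinite 𝒞 using Set.Finite.induction_on with
  | empty => exact absurd (h x y (by simp)) hσ.2.1
  | @insert θ 𝒞 _ _ ih =>
    rcases hσ.prime hc (h𝒞 θ (Set.mem_insert _ _))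
      (isCongruence_sInf fun θ' hθ' => h𝒞 θ' (Set.mem_insert_of_mem _ hθ'))
      (fun u v h₁ h₂ => h u v (by
        rintro θ' (rfl | hθ')
        · exact h₁
        · exact h₂ θ' hθ')) with hle | hle
    · exact ⟨θ, Set.mem_insert _ _, hle⟩
    · obtain ⟨θ', hθ', hle'⟩ := ih (fun θ' hθ' => h𝒞 θ' (Set.mem_insert_of_mem _ hθ')) hle
      exact ⟨θ', Set.mem_insert_of_mem _ hθ', hle'⟩

/-- In a finite congruence distributive algebra, a maximal separating congruence `η` has a
splitting pair: every congruence not below `η` contains it. -/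
theorem MaxSep.exists_splitting [Finite B] (hc : JonssonWitness L p c) {x y : B}
    {η : B → B → Prop} (hη : MaxSep L B x y η) :
    ∃ c d : B, ¬ η c d ∧ ∀ θ, IsCongruence L B θ → ¬ θ c d → θ ≤ η := by
  have hn : ¬ ∀ u v, (∀ θ ∈ {θ | IsCongruence L B θ ∧ ¬ θ ≤ η}, θ u v) → η u v := by
    intro h
    obtain ⟨θ, hθ, hle⟩ := hη.prime_sInf hc _ (fun θ hθ => hθ.1) h
    exact hθ.2 hle
  push Not at hn
  obtain ⟨c, d, h, hcd⟩ := hn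
  exact ⟨c, d, hcd, fun θ hθ hn => by_contra fun hle => hn (h θ ⟨hθ, hle⟩)⟩

end Jonsson

section Definability

variable {L : FirstOrder.Language.{0, 0}} {E : Set (L.Term ℕ × L.Term ℕ)}

/-- In a locally finite variety there are only finitely many terms in a finite set of variables,
up to equivalence. -/
theorem exists_finite_representatives
    (hLF : ∀ (B : Type) [L.Structure B], Satisfies L E B → ∀ s : Finset B,
      Set.Finite ((Substructure.closure L (↑s : Set B) : L.Substructure B) : Set B))
    (α : Type) [Finite α] :
    ∃ (Q : Type) (_ : Finite Q) (rep : Q → L.Term α), ∀ t : L.Term α, ∃ q : Q,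
      ∀ (B : Type) [L.Structure B], Satisfies L E B → ∀ v : α → B,
        t.realize v = (rep q).realize v := by
  classical
  let _ : L.Structure (L.Term α) := { funMap := fun f v => .func f v, RelMap := fun _ _ => True }
  let s : Setoid (L.Term α) :=
    { r := fun t₁ t₂ => ∀ (B : Type) [L.Structure B], Satisfies L E B → ∀ v : α → B,
        t₁.realize v = t₂.realize v
      iseqv := ⟨fun _ _ _ _ _ => rfl, fun h B _ hB v => (h B hB v).symm,
        fun h₁ h₂ B _ hB v => (h₁ B hB v).trans (h₂ B hB v)⟩ }
  have hs : IsCongruence L (L.Term α) s.r :=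
    ⟨s.iseqv, fun f v w h B _ hB u =>
      congrArg (Structure.funMap f) (funext fun i => h i B hB u)⟩
  have hsubst : ∀ {β : Type} (t : L.Term β) (v : β → L.Term α), t.realize v = t.subst v := by
    intro β t v
    induction t with
    | var i => rfl
    | func f ts ih => simp only [Term.realize, Term.subst, ih]; rfl
  let _ := quotStructure (L := L) s
  have hsat : Satisfies L E (Quotient s) := Satisfies.quot hs fun e he v B _ hB u => by
    rw [hsubst, hsubst, Term.realize_subst, Term.realize_subst]
    exact hB e he _
  have hfin := hLF (Quotient s) hsat
    (Set.toFinite (Set.range fun i : α => Quotient.mk s (Term.var i))).toFinset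
  have hall : ∀ t : L.Term α, Quotient.mk s t ∈ (Substructure.closure L
      (↑(Set.toFinite (Set.range fun i : α => Quotient.mk s (Term.var i))).toFinset :
        Set (Quotient s)) : L.Substructure (Quotient s)) := by
    intro t
    induction t with
    | var i => exact Substructure.subset_closure (by simp)
    | func f ts ih =>
      have := Substructure.fun_mem _ f _ ih
      rwa [← quot_funMap hs] at this
  have : Finite (Quotient s) := by
    refine Set.finite_univ_iff.1 (hfin.subset fun q _ => ?_)
    obtain ⟨t, rfl⟩ := Quotient.exists_rep q
    exact hall t
  exact ⟨Quotient s, this, Quotient.out, fun t => ⟨Quotient.mk s t, fun B _ hB v =>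
    s.symm' (Quotient.mk_out (s := s) t) B hB v⟩⟩

/-- A single congruence formula captures membership in principal congruences of all finite
subalgebras generated by the four arguments and a bounded number of further elements. -/
theorem exists_congruenceFormula
    (hLF : ∀ (B : Type) [L.Structure B], Satisfies L E B → ∀ s : Finset B,
      Set.Finite ((Substructure.closure L (↑s : Set B) : L.Substructure B) : Set B))
    (C : ∀ (B : Type) [inst : L.Structure B], Prop)
    (hC : ∀ (B : Type) [L.Structure B], C B → Satisfies L E B) (ι : Type) [Finite ι] :
    ∃ φ : L.Formula (Fin 4), IsCongruenceFormula L C φ ∧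
      ∀ (B : Type) [L.Structure B], C B → ∀ (w x y z : B) (e : ι → B),
        (∀ (S : L.Substructure B) (hw : w ∈ S) (hx : x ∈ S) (hy : y ∈ S) (hz : z ∈ S),
          Finite S → (∀ i, e i ∈ S) → PrinCg L S ⟨y, hy⟩ ⟨z, hz⟩ ⟨w, hw⟩ ⟨x, hx⟩) →
        φ.Realize ![w, x, y, z] := by
  obtain ⟨Q, _, rep, hrep⟩ := exists_finite_representatives hLF (Fin 4 ⊕ ι)
  let Sound : Set (Q × Q) → Prop := fun θ => ∀ (B : Type) [L.Structure B], C B →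
    ∀ v : Fin 4 ⊕ ι → B, (∀ q : θ, (rep q.1.1).realize v = (rep q.1.2).realize v) →
      PrinCg L B (v (.inl 2)) (v (.inl 3)) (v (.inl 0)) (v (.inl 1))
  let φ₀ : L.Formula (Fin 4 ⊕ ι) := Formula.iSup fun θ : {θ // Sound θ} =>
    Formula.iInf fun q : θ.1 => (rep q.1.1).equal (rep q.1.2)
  have hφ₀ : ∀ (B : Type) [L.Structure B] (v : Fin 4 ⊕ ι → B), φ₀.Realize v ↔
      ∃ θ : {θ // Sound θ}, ∀ q : θ.1, (rep q.1.1).realize v = (rep q.1.2).realize v := by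
    intro B _ v
    simp only [φ₀, Formula.realize_iSup, Formula.realize_iInf, Formula.realize_equal]
  refine ⟨φ₀.iExs ι, ?_, ?_⟩
  · intro B _ hB w x y z h
    rw [Formula.realize_iExs] at h
    obtain ⟨e, he⟩ := h
    obtain ⟨θ, hθ⟩ := (hφ₀ B _).1 he
    exact θ.2 B hB _ hθ
  · intro B _ hB w x y z e h
    rw [Formula.realize_iExs]
    refine ⟨e, ?_⟩
    rw [hφ₀]
    set v : Fin 4 ⊕ ι → B := Sum.elim ![w, x, y, z] e with hv
    refine ⟨⟨{q | (rep q.1).realize v = (rep q.2).realize v}, ?_⟩, fun q => q.2⟩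
    intro B' _ hB' v' hv' ρ hρ hyz
    have hext : ∀ t₁ t₂ : L.Term (Fin 4 ⊕ ι), t₁.realize v = t₂.realize v →
        t₁.realize v' = t₂.realize v' := by
      intro t₁ t₂ ht
      obtain ⟨q₁, h₁⟩ := hrep t₁
      obtain ⟨q₂, h₂⟩ := hrep t₂
      rw [h₁ B' (hC B' hB'), h₂ B' (hC B' hB')]
      refine hv' ⟨(q₁, q₂), ?_⟩
      rw [h₁ B (hC B hB), h₂ B (hC B hB)] at ht
      exact ht
    let S : L.Substructure B := Substructure.closure L (Set.range v)
    have hvS : ∀ i, v i ∈ S := fun i => Substructure.subset_closure ⟨i, rfl⟩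
    have hSfin : Finite S := by
      have := hLF B (hC B hB) (Set.toFinite (Set.range v)).toFinset
      rw [Set.Finite.coe_toFinset] at this
      exact this
    have hterm : ∀ u : S, ∃ t : L.Term (Fin 4 ⊕ ι), t.realize v = u := by
      intro u
      obtain ⟨t, ht⟩ := Substructure.mem_closure_iff_exists_term.1 u.2
      choose g hg using fun i : Set.range v => i.2
      refine ⟨t.relabel g, ?_⟩
      rw [Term.realize_relabel, ← ht]
      congr 1
      funext i
      exact hg i
    choose T hT using hterm
    have hcomap := hρ.comap (A := S) (g := fun u => (T u).realize v') fun {n} f u => by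
      refine hext _ (Term.func f fun i => T (u i)) ?_
      rw [hT, Term.realize]
      simp only [hT]
      rfl
    have hTv : ∀ i, (T ⟨v i, hvS i⟩).realize v' = v' i := fun i => hext _ (Term.var i) (hT _)
    have := h S (hvS (.inl 0)) (hvS (.inl 1)) (hvS (.inl 2)) (hvS (.inl 3)) hSfin
      (fun i => hvS (.inr i)) _ hcomap
    have key := this (by
      have h₂ := hTv (.inl 2)
      have h₃ := hTv (.inl 3)
      rw [← h₂, ← h₃] at hyz
      exact hyz)
    have h₀ := hTv (.inl 0)
    have h₁ := hTv (.inl 1)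
    rw [← h₀, ← h₁]
    exact key

end Definability

section Subcongruence

variable {L : FirstOrder.Language.{0, 0}} {B : Type} [L.Structure B] {m K : ℕ}
  {p : Fin (K + 1) → L.Term (Fin m ⊕ Fin 3)} {c₀ : Fin m → B}

/-- If all maximal congruences separating `(c, d)` have a transversal in the finite subalgebra
`S`, then `Cg(c, d)` restricted to `S` is computed inside `S`. -/
theorem prinCg_substructure (hc : JonssonWitness L p c₀) (S : L.Substructure B) [Finite S]
    (hcS : ∀ i, c₀ i ∈ S) (c d x y : S)
    (hS : ∀ (x y : B) (θ : B → B → Prop), MaxSep L B x y θ → ¬ θ c d → ∀ u : B, ∃ s : S, θ u s)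
    (hxy : PrinCg L B c d x y) : PrinCg L S c d x y := by
  intro ρ hρ hcd
  by_contra hn
  obtain ⟨σ, hρσ, hσ⟩ := exists_maxSep hρ hn
  obtain ⟨τ, hτ, hle⟩ := hσ.prime_sInf (hc.substructure S hcS)
    {τ | ∃ θ : B → B → Prop, IsCongruence L B θ ∧ (τ = fun u v : S => θ u v) ∧
      (θ = PrinCg L B c d ∨ ∃ x y, MaxSep L B x y θ ∧ ¬ θ c d)}
    (by rintro _ ⟨θ, hθ, rfl, -⟩; exact hθ.restrict S)
    (by
      intro u v huv
      have : u = v := by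
        by_contra hne
        obtain ⟨θ, -, hθ⟩ := exists_maxSep (L := L) (B := B) (x := u) (y := v) isCongruence_eq
          (fun h => hne (Subtype.ext h))
        by_cases hcdθ : θ c d
        · exact hθ.2.1 (huv _ ⟨_, isCongruence_prinCg _ _, rfl, .inl rfl⟩ θ hθ.1 hcdθ)
        · exact hθ.2.1 (huv _ ⟨θ, hθ.1, rfl, .inr ⟨u, v, hθ, hcdθ⟩⟩)
      subst this
      exact hσ.1.1.refl _)
  obtain ⟨θ, hθ, rfl, rfl | ⟨x', y', hmax, hcdθ⟩⟩ := hτ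
  · exact hσ.2.1 (hle _ _ hxy)
  · obtain ⟨σ', hσ', -, hiff⟩ := exists_extension hθ S (hS x' y' θ hmax hcdθ) hσ.1 hle
    exact hσ.2.1 ((hiff _ _).1 (hxy σ' hσ' ((hiff _ _).2 (hρσ _ _ hcd))))

/-- If every class of `η` meets `S`, `θ` restricted to `S` is below `η`, and `θ` has at most as
many classes as `η`, then every class of `θ` meets `S`. -/
theorem exists_rel_of_card_le {s t : Setoid B} [Finite (Quotient s)] [Finite (Quotient t)]
    {S : Set B} (hS : ∀ u : B, ∃ s' ∈ S, s u s') (hle : ∀ u ∈ S, ∀ v ∈ S, t u v → s u v)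
    (hcard : Nat.card (Quotient t) ≤ Nat.card (Quotient s)) (u : B) : ∃ v ∈ S, t u v := by
  choose g hgS hg using hS
  let F : Quotient s → Quotient t := fun q => Quotient.mk t (g q.out)
  have hF : Function.Injective F := by
    intro q₁ q₂ h
    have h' : s (g q₁.out) (g q₂.out) := hle _ (hgS _) _ (hgS _) (Quotient.exact h)
    rw [← Quotient.out_eq q₁, ← Quotient.out_eq q₂]
    exact Quotient.sound (s.trans' (hg _) (s.trans' h' (s.symm' (hg _))))
  have hF' : Function.Surjective F :=
    ((Nat.bijective_iff_injective_and_card F).2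
      ⟨hF, (Nat.card_le_card_of_injective F hF).antisymm hcard⟩).2
  obtain ⟨q, hq⟩ := hF' (Quotient.mk t u)
  exact ⟨g q.out, hgS _, t.symm' (Quotient.exact hq)⟩

end Subcongruence

/-- In a congruence distributive algebra of a locally finite residually bounded variety, every
nontrivial principal congruence contains a pair whose principal congruence is computed in
subalgebras generated by boundedly many elements. -/
theorem exists_local_subpair {L : FirstOrder.Language.{0, 0}} {E : Set (L.Term ℕ × L.Term ℕ)}
    (hLF : ∀ (B : Type) [L.Structure B], Satisfies L E B → ∀ s : Finset B,
      Set.Finite ((Substructure.closure L (↑s : Set B) : L.Substructure B) : Set B))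
    {N : ℕ}
    (hκ : ∀ (B : Type) [L.Structure B], Satisfies L E B → IsSI L B → Finite B ∧ Nat.card B < N)
    {m K : ℕ} {p : Fin (K + 1) → L.Term (Fin m ⊕ Fin 3)} {B : Type} [L.Structure B]
    (hB : Satisfies L E B) {c₀ : Fin m → B} (hc₀ : JonssonWitness L p c₀) {a b : B}
    (hab : a ≠ b) :
    ∃ (e : (Fin m ⊕ Fin N) ⊕ Fin 2 → B) (c d : B), c ≠ d ∧
      ∀ (S : L.Substructure B) (ha : a ∈ S) (hb : b ∈ S) (hc : c ∈ S) (hd : d ∈ S),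
        (∀ i, e i ∈ S) → PrinCg L S ⟨a, ha⟩ ⟨b, hb⟩ ⟨c, hc⟩ ⟨d, hd⟩ ∧
          (Finite S → ∀ x y : S, PrinCg L B c d x y → PrinCg L S ⟨c, hc⟩ ⟨d, hd⟩ x y) := by
  classical
  have hbound : ∀ (s : Setoid B) (x y : B), MaxSep L B x y s.r →
      Finite (Quotient s) ∧ Nat.card (Quotient s) < N := fun s x y h =>
    @hκ (Quotient s) (quotStructure s)
      (Satisfies.quot h.1 fun e he v => by rw [hB e he v]) h.isSI
  let P : ℕ → Prop := fun k => ∃ (s : Setoid B) (x y : B), MaxSep L B x y s.r ∧ ¬ s a b ∧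
    Nat.card (Quotient s) = k
  have hP : ∃ k, P k := by
    obtain ⟨η, -, hη⟩ := exists_maxSep (L := L) (B := B) isCongruence_eq hab
    exact ⟨_, ⟨η, hη.1.1⟩, a, b, hη, hη.2.1, rfl⟩
  have hPN : ∀ k, P k → k ≤ N := by
    rintro _ ⟨s, x, y, h, -, rfl⟩
    exact (hbound s x y h).2.le
  obtain ⟨k₀, hk₀⟩ := hP
  obtain ⟨s, x₀, y₀, hη, hηab, hcard⟩ := Nat.findGreatest_spec (P := P) (hPN k₀ hk₀) hk₀
  have hmax : ∀ (t : Setoid B) (x y : B), MaxSep L B x y t.r → ¬ t a b →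
      Nat.card (Quotient t) ≤ Nat.card (Quotient s) := by
    intro t x y h hn
    have hPt : P (Nat.card (Quotient t)) := ⟨t, x, y, h, hn, rfl⟩
    rw [hcard]
    exact Nat.le_findGreatest (hPN _ hPt) hPt
  obtain ⟨hfin, hlt⟩ := hbound s x₀ y₀ hη
  obtain ⟨r, hr⟩ : ∃ r : Fin N → B, ∀ u, ∃ i, s u (r i) := by
    have : Nonempty (Quotient s) := ⟨Quotient.mk s a⟩
    let emb : Quotient s → Fin N := fun q => Fin.castLE hlt.le (Finite.equivFin _ q)
    have hemb : Function.Injective emb :=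
      (Fin.castLE_injective hlt.le).comp (Finite.equivFin _).injective
    refine ⟨fun i => (Function.invFun emb i).out, fun u => ⟨emb (Quotient.mk s u), ?_⟩⟩
    simp only [Function.leftInverse_invFun hemb (Quotient.mk s u)]
    exact s.symm' (Quotient.mk_out u)
  let e : (Fin m ⊕ Fin N) ⊕ Fin 2 → B := Sum.elim (Sum.elim c₀ r) ![a, b]
  let S₀ : L.Substructure B := Substructure.closure L (Set.range e)
  have he₀ : ∀ i, e i ∈ S₀ := fun i => Substructure.subset_closure ⟨i, rfl⟩
  have hS₀fin : Finite S₀ := by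
    have := hLF B hB (Set.toFinite (Set.range e)).toFinset
    rw [Set.Finite.coe_toFinset] at this
    exact this
  have hmeet : ∀ u : B, ∃ v : S₀, s u v := fun u =>
    let ⟨i, hi⟩ := hr u
    ⟨⟨r i, he₀ (.inl (.inr i))⟩, hi⟩
  obtain ⟨x₁, y₁, hη₀⟩ := hη.restrict S₀ hmeet
  obtain ⟨c, d, hcd, hsplit⟩ :=
    hη₀.exists_splitting (hc₀.substructure S₀ fun i => he₀ (.inl (.inl i)))
  refine ⟨e, c, d, fun h => hcd (by rw [h]), ?_⟩
  intro S ha hb hc hd heS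
  have hle : S₀ ≤ S := Substructure.closure_le.2 (by rintro _ ⟨i, rfl⟩; exact heS i)
  refine ⟨fun ρ hρ hρab => ?_, fun _ x y hxy => ?_⟩
  · by_contra hn
    have := hsplit _ (hρ.comap (A := S₀) (g := Substructure.inclusion hle) fun f v =>
      (Substructure.inclusion hle).map_fun f v) hn
    exact hηab (this ⟨a, he₀ (.inr 0)⟩ ⟨b, he₀ (.inr 1)⟩ hρab)
  · refine prinCg_substructure hc₀ S (fun i => heS (.inl (.inl i))) ⟨c, hc⟩ ⟨d, hd⟩ x y ?_ hxy
    intro x' y' θ hθ hθcd u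
    let t : Setoid B := ⟨θ, hθ.1.1⟩
    have hθη := hsplit _ (hθ.1.restrict S₀) hθcd
    have hθab : ¬ t a b := fun h => hηab (hθη ⟨a, he₀ (.inr 0)⟩ ⟨b, he₀ (.inr 1)⟩ h)
    have := (hbound t x' y' hθ).1
    obtain ⟨v, hv, huv⟩ := exists_rel_of_card_le (s := s) (t := t) (S := (S₀ : Set B))
      (fun u => let ⟨v, hv⟩ := hmeet u; ⟨v, v.2, hv⟩)
      (fun u hu v hv h => hθη ⟨u, hu⟩ ⟨v, hv⟩ h) (hmax t x' y' hθ hθab) u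
    exact ⟨⟨v, hle hv⟩, huv⟩

/-- Let `V` be a locally finite variety with residual bound
`κ(V) = N < ω`, let `P(c̄) = {p_j(c̄,x₁,x₂,x₃) : j ≤ K}` be terms of `V` with a
fixed finite tuple `c̄` of constant symbols, and let `J(c̄)` be the set of Jónsson
identities for `P(c̄)` in the variables `x₁,x₂,x₃`.  Then the class
`M = Mod_V(∃c̄ J(c̄))` has definable principal subcongruences. -/
theorem jonsson_dpsc (L : FirstOrder.Language.{0, 0})
    -- `V` is a variety: the class of models of a set `E` of identities
    (E : Set (L.Term ℕ × L.Term ℕ))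
    (V : ∀ (B : Type) [inst : L.Structure B], Prop)
    (hV : ∀ (B : Type) [L.Structure B],
      V B ↔ ∀ e ∈ E, ∀ v : ℕ → B, e.1.realize v = e.2.realize v)
    -- `V` is locally finite
    (hLF : ∀ (B : Type) [L.Structure B], V B → ∀ s : Finset B,
      Set.Finite ((Substructure.closure L (↑s : Set B) : L.Substructure B) : Set B))
    -- `κ(V) = N < ω`
    (N : ℕ)
    (hκ : ∀ (B : Type) [L.Structure B], V B → IsSI L B → Finite B ∧ Nat.card B < N)
    -- the terms `p_j(c̄, x₁, x₂, x₃)`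
    (m K : ℕ) (p : Fin (K + 1) → L.Term (Fin m ⊕ Fin 3)) :
    HasDPSC L (fun B inst => @V B inst ∧ ∃ c : Fin m → B, @JonssonWitness L B inst m K p c) := by
  obtain rfl : V = fun B inst => @Satisfies L E B inst := by
    funext B inst
    exact propext (hV B)
  obtain ⟨φ, hφ, hφ'⟩ := exists_congruenceFormula hLF
    (fun B inst => @Satisfies L E B inst ∧ ∃ c : Fin m → B, @JonssonWitness L B inst m K p c)
    (fun _ _ h => h.1) ((Fin m ⊕ Fin N) ⊕ Fin 2)
  obtain ⟨ψ, hψ, hψ'⟩ := exists_congruenceFormula hLF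
    (fun B inst => @Satisfies L E B inst ∧ ∃ c : Fin m → B, @JonssonWitness L B inst m K p c)
    (fun _ _ h => h.1) (((Fin m ⊕ Fin N) ⊕ Fin 2) ⊕ Fin 2)
  refine ⟨φ, ψ, hφ, hψ, fun B _ hB a b hab => ?_⟩
  obtain ⟨c₀, hc₀⟩ := hB.2
  obtain ⟨e, c, d, hcd, h⟩ := exists_local_subpair hLF hκ hB.1 hc₀ hab
  refine ⟨c, d, hcd, hφ' B hB c d a b e fun S hc hd ha hb _ heS => (h S ha hb hc hd heS).1,
    fun x y => ⟨fun hxy => ?_, hψ B hB x y c d⟩⟩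
  exact hψ' B hB x y c d (Sum.elim e ![a, b]) fun S hx hy hc hd hfin heS =>
    (h S (heS (.inr 0)) (heS (.inr 1)) hc hd fun i => heS (.inl i)).2 hfin ⟨x, hx⟩ ⟨y, hy⟩ hxy

end McKenzie
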